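/- Let a_1,...,a_l and b_1,...,b_l be nonnegative integers and let q ≥ max(∑_m m·a_m, ∑_m m·b_m). Then the Haar average ∫_{U(q)} ∏_{m=1}^l Tr(U^m)^{a_m} Tr(U^{-m})^{b_m} dU equals δ_{a,b} ∏_{m=1}^l m^{a_m} a_m!, where δ_{a,b} = 1 if a_m = b_m for all m and 0 otherwise. -/

import Mathlib

open Finset MeasureTheory

set_option linter.unusedSectionVars false

namespace DS

/-- A unit complex number which is not a root of unity. -/
lemma exists_unit : ∃ z : ℂ, star z * z = 1 ∧ ∀ a b : ℕ, z ^ a = z ^ b → a = b := by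
  refine ⟨Complex.exp Complex.I, ?_, ?_⟩
  · have : star (Complex.exp Complex.I) = Complex.exp (-Complex.I) := by
      rw [Complex.star_def, ← Complex.exp_conj, Complex.conj_I]
    rw [this, ← Complex.exp_add]; simp
  · intro a b h
    rw [← Complex.exp_nat_mul, ← Complex.exp_nat_mul, Complex.exp_eq_exp_iff_exists_int] at h
    obtain ⟨n, hn⟩ := h
    have h1 : (a : ℝ) = b + n * (2 * Real.pi) := by
      have := congrArg Complex.im hn
      simpa using this
    by_cases hn0 : n = 0
    · subst hn0
      simpa using h1
    · exfalso
      apply irrational_pi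
      refine ⟨((a : ℚ) - b) / (2 * n), ?_⟩
      have : (n : ℝ) ≠ 0 := by exact_mod_cast hn0
      push_cast
      field_simp
      linarith

variable {α : Type} [Fintype α] [DecidableEq α] {q : ℕ}

/-- Tensor power of a matrix. -/
def T (α : Type) [Fintype α] {q : ℕ} (A : Matrix (Fin q) (Fin q) ℂ) :
    Matrix (α → Fin q) (α → Fin q) ℂ :=
  Matrix.of fun i j => ∏ x, A (i x) (j x)

lemma T_apply (A : Matrix (Fin q) (Fin q) ℂ) (i j : α → Fin q) :
    T α A i j = ∏ x, A (i x) (j x) := rfl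

lemma T_mul (A B : Matrix (Fin q) (Fin q) ℂ) : T α (A * B) = T α A * T α B := by
  ext i j
  simp only [T_apply, Matrix.mul_apply, Fintype.prod_sum, Finset.prod_mul_distrib]

lemma T_func (f : Fin q → Fin q) (i j : α → Fin q) :
    T α (Matrix.of fun r s => if r = f s then 1 else 0) i j = if i = f ∘ j then 1 else 0 := by
  rw [T_apply]
  split_ifs with h
  · subst h; simp
  · obtain ⟨x, hx⟩ := Function.ne_iff.1 h
    exact Finset.prod_eq_zero (Finset.mem_univ x) (by simpa using hx)

lemma T_diag (d : Fin q → ℂ) : T α (Matrix.diagonal d) = Matrix.diagonal fun i => ∏ x, d (i x) := by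
  ext i j
  rw [T_apply, Matrix.diagonal_apply]
  split_ifs with h
  · subst h; simp
  · obtain ⟨x, hx⟩ := Function.ne_iff.1 h
    exact Finset.prod_eq_zero (Finset.mem_univ x) (by simp [hx])

lemma T_one : T α (1 : Matrix (Fin q) (Fin q) ℂ) = 1 := by
  rw [← Matrix.diagonal_one, T_diag]; simp

lemma T_star (A : Matrix (Fin q) (Fin q) ℂ) (i j : α → Fin q) :
    T α (star A) i j = star (T α A j i) := by
  simp [T_apply, Matrix.star_apply]

/-- `X` commutes with the tensor powers of unitaries. -/
def Comm (X : Matrix (α → Fin q) (α → Fin q) ℂ) : Prop :=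
  ∀ V : Matrix.unitaryGroup (Fin q) ℂ, T α (V : Matrix (Fin q) (Fin q) ℂ) * X = X * T α V

lemma diag_mem {d : Fin q → ℂ} (hd : ∀ r, star (d r) * d r = 1) :
    Matrix.diagonal d ∈ Matrix.unitaryGroup (Fin q) ℂ := by
  rw [Matrix.mem_unitaryGroup_iff', Matrix.star_eq_conjTranspose, Matrix.diagonal_conjTranspose,
    Matrix.diagonal_mul_diagonal, ← Matrix.diagonal_one]
  congr 1
  ext r
  exact hd r

lemma prod_count (d : Fin q → ℂ) (i : α → Fin q) :
    ∏ x, d (i x) = ∏ r, d r ^ (#{x | i x = r}) := by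
  rw [← Finset.prod_fiberwise (Finset.univ) i (fun x => d (i x))]
  refine Finset.prod_congr rfl fun r _ => ?_
  rw [← Finset.prod_const]
  refine Finset.prod_congr rfl fun x hx => ?_
  rw [(Finset.mem_filter.1 hx).2]

lemma weight {X : Matrix (α → Fin q) (α → Fin q) ℂ} (hX : Comm X) (i j : α → Fin q)
    (h : X i j ≠ 0) (r : Fin q) : #{x | i x = r} = #{x | j x = r} := by
  obtain ⟨z, hz, hz'⟩ := exists_unit
  let d : Fin q → ℂ := Function.update 1 r z
  have hd : ∀ s, star (d s) * d s = 1 := by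
    intro s
    by_cases hs : s = r
    · subst hs; simpa [d] using hz
    · simp [d, hs]
  have h1 := congrFun (congrFun (hX ⟨_, diag_mem hd⟩) i) j
  simp only [T_diag, Matrix.diagonal_mul, Matrix.mul_diagonal] at h1
  rw [mul_comm] at h1
  have h2 := mul_left_cancel₀ h h1
  have h3 : ∀ k : α → Fin q, ∏ x, d (k x) = z ^ (#{x | k x = r}) := by
    intro k
    rw [prod_count, Finset.prod_eq_single r]
    · simp [d]
    · intro s _ hs; simp [d, hs]
    · simp
  rw [h3, h3] at h2
  exact hz' _ _ h2

lemma comm_diag {X : Matrix (α → Fin q) (α → Fin q) ℂ} (hX : Comm X) (d : Fin q → ℂ) :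
    T α (Matrix.diagonal d) * X = X * T α (Matrix.diagonal d) := by
  ext i j
  simp only [T_diag, Matrix.diagonal_mul, Matrix.mul_diagonal]
  by_cases h : X i j = 0
  · simp [h]
  · rw [prod_count d i, prod_count d j]
    simp only [weight hX i j h]
    ring

lemma comm_mul {X : Matrix (α → Fin q) (α → Fin q) ℂ} {A B : Matrix (Fin q) (Fin q) ℂ}
    (hA : T α A * X = X * T α A) (hB : T α B * X = X * T α B) :
    T α (A * B) * X = X * T α (A * B) := by
  rw [T_mul, Matrix.mul_assoc, hB, ← Matrix.mul_assoc, hA, Matrix.mul_assoc]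

lemma comm_herm {X : Matrix (α → Fin q) (α → Fin q) ℂ} (hX : Comm X)
    {A : Matrix (Fin q) (Fin q) ℂ} (hA : A.IsHermitian) :
    T α A * X = X * T α A := by
  rw [hA.spectral_theorem, Unitary.conjStarAlgAut_apply]
  exact comm_mul (comm_mul (hX _) (comm_diag hX _)) (hX (star hA.eigenvectorUnitary))

open Polynomial in
lemma comm_all {X : Matrix (α → Fin q) (α → Fin q) ℂ} (hX : Comm X)
    (A : Matrix (Fin q) (Fin q) ℂ) :
    T α A * X = X * T α A := by
  obtain ⟨H, K, hH, hK, hA⟩ : ∃ H K : Matrix (Fin q) (Fin q) ℂ, H.IsHermitian ∧ K.IsHermitian ∧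
      A = H + Complex.I • K :=
    ⟨realPart A, imaginaryPart A, (realPart A).2, (imaginaryPart A).2,
      (realPart_add_I_smul_imaginaryPart A).symm⟩
  ext i j
  let p : ℂ[X] := ∑ k : α → Fin q, (∏ x, (C (H (i x) (k x)) + Polynomial.X * C (K (i x) (k x)))) * C (X k j)
    - ∑ k : α → Fin q, C (X i k) * (∏ x, (C (H (k x) (j x)) + Polynomial.X * C (K (k x) (j x))))
  have hp : ∀ t : ℂ, p.eval t = (T α (H + t • K) * X) i j - (X * T α (H + t • K)) i j := by
    intro t
    simp [p, Matrix.mul_apply, T_apply, eval_finsetSum, eval_prod, mul_comm t]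
  have hp0 : p = 0 := by
    apply Polynomial.eq_zero_of_infinite_isRoot
    refine Set.Infinite.mono ?_ (Set.infinite_range_of_injective Complex.ofReal_injective)
    rintro _ ⟨t, rfl⟩
    change p.eval _ = 0
    rw [hp, comm_herm hX, sub_self]
    refine hH.add ?_
    rw [Matrix.IsHermitian, Matrix.conjTranspose_smul, hK.eq]
    simp
  have := hp Complex.I
  rw [hp0, eval_zero, ← hA] at this
  exact (sub_eq_zero.1 this.symm)

lemma exists_perm {e : α → Fin q} (he : Function.Injective e) (k : α → Fin q)
    (h : ∀ r, #{x | k x = r} = #{x | e x = r}) : ∃ π : Equiv.Perm α, k = e ∘ π := by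
  have h1 : ∀ x, ∃ y, e y = k x := by
    intro x
    have : 0 < #{y | e y = k x} := by
      rw [← h]
      exact Finset.card_pos.2 ⟨x, by simp⟩
    obtain ⟨y, hy⟩ := Finset.card_pos.1 this
    exact ⟨y, by simpa using hy⟩
  choose f hf using h1
  have hinj : Function.Injective f := by
    intro x y hxy
    have hk : k x = k y := by rw [← hf, ← hf, hxy]
    have : #{z | k z = k y} ≤ 1 := by
      rw [h]
      apply Finset.card_le_one.2
      intro a ha b hb
      simp only [Finset.mem_filter, Finset.mem_univ, true_and] at ha hb
      exact he (ha.trans hb.symm)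
    exact Finset.card_le_one.1 this x (by simp [hk]) y (by simp)
  refine ⟨Equiv.ofBijective f (Finite.injective_iff_bijective.1 hinj), ?_⟩
  ext x
  simp [hf]

/-- Schur–Weyl: the commutant is spanned by permutation operators. -/
lemma commutant {X : Matrix (α → Fin q) (α → Fin q) ℂ} (hX : Comm X)
    {e : α → Fin q} (he : Function.Injective e) (i j : α → Fin q) :
    X i j = ∑ π : Equiv.Perm α, if i = j ∘ π then X (e ∘ π) e else 0 := by
  let f : Fin q → Fin q := Function.extend e j id
  have hfe : f ∘ e = j := by
    ext x; simp [f, he.extend_apply]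
  have h := congrFun (congrFun (comm_all hX (Matrix.of fun r s => if r = f s then 1 else 0)) i) e
  simp only [Matrix.mul_apply, T_func, hfe] at h
  simp only [mul_ite, mul_one, mul_zero, Finset.sum_ite_eq', Finset.mem_univ, if_true, ite_mul,
    one_mul, zero_mul] at h
  rw [← h]
  symm
  refine Finset.sum_of_injOn (fun π : Equiv.Perm α => e ∘ π) ?_ ?_ ?_ ?_
  · intro π _ ρ _ hπ
    ext x
    exact he (congrFun hπ x)
  · intro π _; simp
  · intro k _ hk
    have : X k e = 0 := by
      by_contra h0
      obtain ⟨π, hπ⟩ := exists_perm he k (weight hX k e h0)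
      exact hk ⟨π, by simp, hπ.symm⟩
    simp [this]
  · intro π _
    rw [← Function.comp_assoc, hfe]

section integral

variable [MeasurableSpace (Matrix.unitaryGroup (Fin q) ℂ)]
    [BorelSpace (Matrix.unitaryGroup (Fin q) ℂ)]
    (μ : Measure (Matrix.unitaryGroup (Fin q) ℂ))
    [μ.IsHaarMeasure] [IsProbabilityMeasure μ]

lemma T_cont (i j : α → Fin q) :
    Continuous fun U : Matrix.unitaryGroup (Fin q) ℂ => T α (U : Matrix (Fin q) (Fin q) ℂ) i j := by
  simp only [T_apply]
  refine continuous_finsetProd _ fun x _ => ?_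
  exact (continuous_subtype_val).matrix_elem _ _

lemma T_norm (i j : α → Fin q) (U : Matrix.unitaryGroup (Fin q) ℂ) :
    ‖T α (U : Matrix (Fin q) (Fin q) ℂ) i j‖ ≤ 1 := by
  rw [T_apply, norm_prod]
  exact Finset.prod_le_one (fun _ _ => norm_nonneg _)
    fun x _ => entry_norm_bound_of_unitary U.2 _ _

lemma integ (i j k l : α → Fin q) :
    Integrable (fun U : Matrix.unitaryGroup (Fin q) ℂ =>
      T α (U : Matrix (Fin q) (Fin q) ℂ) i k * star (T α (U : Matrix (Fin q) (Fin q) ℂ) j l)) μ := by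
  refine Integrable.of_bound ((T_cont i k).mul (T_cont j l).star).aestronglyMeasurable 1 ?_
  refine Filter.Eventually.of_forall fun U => ?_
  rw [norm_mul, norm_star]
  exact mul_le_one₀ (T_norm _ _ _) (norm_nonneg _) (T_norm _ _ _)

/-- Haar second moment matrix. -/
noncomputable def M (k l : α → Fin q) : Matrix (α → Fin q) (α → Fin q) ℂ :=
  Matrix.of fun i j => ∫ U : Matrix.unitaryGroup (Fin q) ℂ,
      T α (U : Matrix (Fin q) (Fin q) ℂ) i k * star (T α (U : Matrix (Fin q) (Fin q) ℂ) j l) ∂μ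

lemma M_comm (k l : α → Fin q) : Comm (M μ k l) := by
  intro V
  ext i j
  simp only [Matrix.mul_apply, M, Matrix.of_apply]
  simp_rw [← integral_const_mul, ← integral_mul_const]
  rw [← integral_finsetSum _ fun a _ => (integ μ _ _ _ _).const_mul _,
    ← integral_finsetSum _ fun a _ => (integ μ _ _ _ _).mul_const _]
  rw [← integral_mul_left_eq_self (μ := μ) (fun U : Matrix.unitaryGroup (Fin q) ℂ =>
    ∑ b, T α (U : Matrix (Fin q) (Fin q) ℂ) i k * star (T α (U : Matrix (Fin q) (Fin q) ℂ) b l)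
      * T α (V : Matrix (Fin q) (Fin q) ℂ) b j) V]
  refine integral_congr_ae (Filter.Eventually.of_forall fun U => ?_)
  have h1 : T α ((V * U : Matrix.unitaryGroup (Fin q) ℂ) : Matrix (Fin q) (Fin q) ℂ) i k
      = ∑ a, T α (V : Matrix (Fin q) (Fin q) ℂ) i a * T α (U : Matrix (Fin q) (Fin q) ℂ) a k := by
    rw [Matrix.UnitaryGroup.mul_val, T_mul, Matrix.mul_apply]
  have h2 : T α (U : Matrix (Fin q) (Fin q) ℂ) j l =
      ∑ b, star (T α (V : Matrix (Fin q) (Fin q) ℂ) b j) *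
        T α ((V * U : Matrix.unitaryGroup (Fin q) ℂ) : Matrix (Fin q) (Fin q) ℂ) b l := by
    simp_rw [← T_star]
    rw [← Matrix.mul_apply, ← T_mul]
    congr 2
    rw [Matrix.UnitaryGroup.mul_val, ← Matrix.mul_assoc, Matrix.UnitaryGroup.star_mul_self,
      Matrix.one_mul]
  trans T α ((V * U : Matrix.unitaryGroup (Fin q) ℂ) : Matrix (Fin q) (Fin q) ℂ) i k *
    star (T α (U : Matrix (Fin q) (Fin q) ℂ) j l)
  · rw [h1, Finset.sum_mul]
    exact Finset.sum_congr rfl fun a _ => by ring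
  · rw [h2, star_sum, Finset.mul_sum]
    refine Finset.sum_congr rfl fun b _ => ?_
    rw [star_mul', star_star]
    ring

lemma M_sum {e : α → Fin q} (he : Function.Injective e) (π ρ : Equiv.Perm α) :
    ∑ l : α → Fin q, M μ (l ∘ ρ) l (e ∘ π) e = if π = ρ then 1 else 0 := by
  simp only [M, Matrix.of_apply]
  rw [← integral_finsetSum _ fun a _ => (integ μ _ _ _ _)]
  have : ∀ U : Matrix.unitaryGroup (Fin q) ℂ, ∑ l : α → Fin q,
      T α (U : Matrix (Fin q) (Fin q) ℂ) (e ∘ π) (l ∘ ρ) *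
        star (T α (U : Matrix (Fin q) (Fin q) ℂ) e l) = if π = ρ then 1 else 0 := by
    intro U
    have h1 : ∀ l : α → Fin q, T α (U : Matrix (Fin q) (Fin q) ℂ) (e ∘ π) (l ∘ ρ) =
        T α (U : Matrix (Fin q) (Fin q) ℂ) (e ∘ π ∘ ρ.symm) l := by
      intro l
      rw [T_apply, T_apply]
      refine Fintype.prod_equiv ρ _ _ fun x => ?_
      simp
    simp_rw [h1, ← T_star]
    rw [← Matrix.mul_apply, ← T_mul, ← Matrix.UnitaryGroup.inv_val,
      ← Matrix.UnitaryGroup.mul_val, mul_inv_cancel, Matrix.UnitaryGroup.one_val, T_one,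
      Matrix.one_apply]
    congr 1
    apply propext
    constructor
    · intro h
      ext x
      have := he (congrFun h (ρ x))
      simpa using this
    · rintro rfl
      ext x; simp
  simp_rw [this]
  simp

/-- The trace of a permutation operator times a tensor power. -/
noncomputable def tr (σ : Equiv.Perm α) (A : Matrix (Fin q) (Fin q) ℂ) : ℂ :=
  ∑ i : α → Fin q, ∏ x, A (i x) (i (σ x))

lemma main_integral {e : α → Fin q} (he : Function.Injective e) (σ τ : Equiv.Perm α) :
    ∫ U : Matrix.unitaryGroup (Fin q) ℂ, tr σ (U : Matrix (Fin q) (Fin q) ℂ) *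
      tr τ ((U⁻¹ : Matrix.unitaryGroup (Fin q) ℂ) : Matrix (Fin q) (Fin q) ℂ) ∂μ =
    ∑ π : Equiv.Perm α, if π = τ * π * σ then 1 else 0 := by
  have h1 : ∀ U : Matrix.unitaryGroup (Fin q) ℂ, tr σ (U : Matrix (Fin q) (Fin q) ℂ) *
      tr τ ((U⁻¹ : Matrix.unitaryGroup (Fin q) ℂ) : Matrix (Fin q) (Fin q) ℂ) =
      ∑ k : α → Fin q, ∑ l : α → Fin q, T α (U : Matrix (Fin q) (Fin q) ℂ) k (k ∘ σ) *
        star (T α (U : Matrix (Fin q) (Fin q) ℂ) (l ∘ τ) l) := by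
    intro U
    rw [tr, tr, Finset.sum_mul_sum]
    simp_rw [← T_star]
    rfl
  simp_rw [h1]
  rw [integral_finsetSum _ fun k _ => integrable_finsetSum _ fun l _ => integ μ _ _ _ _]
  simp_rw [integral_finsetSum _ fun l _ => integ μ _ (l ∘ τ) _ l]
  have h2 : ∀ k l : α → Fin q, ∫ U : Matrix.unitaryGroup (Fin q) ℂ,
      T α (U : Matrix (Fin q) (Fin q) ℂ) k (k ∘ σ) *
        star (T α (U : Matrix (Fin q) (Fin q) ℂ) (l ∘ τ) l) ∂μ =
      ∑ π : Equiv.Perm α, if k = (l ∘ τ) ∘ π then M μ (k ∘ σ) l (e ∘ π) e else 0 := by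
    intro k l
    exact commutant (M_comm μ (k ∘ σ) l) he k (l ∘ τ)
  simp_rw [h2]
  rw [Finset.sum_comm]
  simp_rw [fun l : α → Fin q => Finset.sum_comm (s := (Finset.univ : Finset (α → Fin q)))
    (t := (Finset.univ : Finset (Equiv.Perm α)))
    (f := fun k π => if k = (l ∘ τ) ∘ π then M μ (k ∘ σ) l (e ∘ π) e else 0)]
  simp only [Finset.sum_ite_eq', Finset.mem_univ, if_true]
  rw [Finset.sum_comm]
  refine Finset.sum_congr rfl fun π _ => ?_
  exact M_sum μ he π (τ * π * σ)

end integral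

section combinatorics

variable {β : Type} [Fintype β] [DecidableEq β]

lemma tr_permCongr (f : α ≃ β) (σ : Equiv.Perm α) (A : Matrix (Fin q) (Fin q) ℂ) :
    tr (f.permCongr σ) A = tr σ A := by
  unfold tr
  symm
  refine Fintype.sum_equiv (f.arrowCongr (Equiv.refl _)) _ _ fun i => ?_
  refine Fintype.prod_equiv f _ _ fun x => ?_
  simp

lemma tr_sumCongr (σ : Equiv.Perm α) (τ : Equiv.Perm β) (A : Matrix (Fin q) (Fin q) ℂ) :
    tr (Equiv.Perm.sumCongr σ τ) A = tr σ A * tr τ A := by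
  unfold tr
  rw [Finset.sum_mul_sum, ← Fintype.sum_prod_type']
  refine Fintype.sum_equiv (Equiv.sumArrowEquivProdArrow _ _ _) _ _ fun i => ?_
  simp [Fintype.prod_sum_type, Equiv.sumArrowEquivProdArrow]

lemma pow_path (A : Matrix (Fin q) (Fin q) ℂ) (n : ℕ) (i j : Fin q) :
    (A ^ (n + 1)) i j = ∑ p : Fin n → Fin q,
      ∏ x, A ((Fin.cons i p : Fin (n + 1) → Fin q) x) ((Fin.snoc p j : Fin (n + 1) → Fin q) x) := by
  induction n generalizing i with
  | zero => simp [Fin.snoc]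
  | succ n ih =>
    rw [pow_succ', Matrix.mul_apply]
    simp_rw [ih, Finset.mul_sum]
    rw [← Fintype.sum_prod_type']
    refine Fintype.sum_equiv (Fin.consEquiv fun _ => Fin q) _ _ fun kp => ?_
    obtain ⟨k, p⟩ := kp
    rw [Fin.prod_univ_succ (n := n + 1)]
    have h : (Fin.snoc (Fin.cons k p : Fin (n + 1) → Fin q) j : Fin (n + 2) → Fin q) =
        Fin.cons k (Fin.snoc p j : Fin (n + 1) → Fin q) :=
      (Fin.cons_snoc_eq_snoc_cons k p j).symm
    change _ = A _ ((Fin.snoc (Fin.cons k p : Fin (n + 1) → Fin q) j : Fin (n + 2) → Fin q) 0) *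
      ∏ x : Fin (n + 1), A _
        ((Fin.snoc (Fin.cons k p : Fin (n + 1) → Fin q) j : Fin (n + 2) → Fin q) x.succ)
    rw [h]
    rfl

lemma tr_finRotate (A : Matrix (Fin q) (Fin q) ℂ) (m : ℕ) (hm : 1 ≤ m) :
    tr (finRotate m) A = Matrix.trace (A ^ m) := by
  obtain ⟨n, rfl⟩ : ∃ n, m = n + 1 := ⟨m - 1, by omega⟩
  rw [Matrix.trace]
  simp only [Matrix.diag_apply, pow_path]
  rw [tr, ← Fintype.sum_prod_type']
  symm
  refine Fintype.sum_equiv (Fin.consEquiv fun _ => Fin q) _ _ fun kp => ?_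
  simp only [Fin.consEquiv_apply, Fin.snoc_eq_cons_rotate]

lemma cycleType_of_extend {f : α ↪ β} {σ : Equiv.Perm α} {τ : Equiv.Perm β}
    (h1 : ∀ x, τ (f x) = f (σ x)) (h2 : ∀ y, (∀ x, f x ≠ y) → τ y = y) :
    τ.cycleType = σ.cycleType := by
  classical
  rw [← Equiv.Perm.cycleType_extendDomain (Equiv.ofInjective f f.injective) (g := σ)]
  congr 1
  ext y
  by_cases hy : ∃ x, f x = y
  · obtain ⟨x, rfl⟩ := hy
    rw [h1]
    have := Equiv.Perm.extendDomain_apply_image σ (Equiv.ofInjective f f.injective) x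
    simpa using this.symm
  · rw [h2 y (by simpa using hy), Equiv.Perm.extendDomain_apply_not_subtype]
    simpa using hy

lemma cycleType_permCongr (f : α ≃ β) (σ : Equiv.Perm α) :
    (f.permCongr σ).cycleType = σ.cycleType :=
  cycleType_of_extend (f := f.toEmbedding) (by simp) (fun y hy => (hy (f.symm y) (by simp)).elim)

lemma cycleType_sumCongr (σ : Equiv.Perm α) (τ : Equiv.Perm β) :
    (Equiv.Perm.sumCongr σ τ).cycleType = σ.cycleType + τ.cycleType := by
  have h : Equiv.Perm.sumCongr σ τ = Equiv.Perm.sumCongr σ 1 * Equiv.Perm.sumCongr 1 τ := by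
    rw [Equiv.Perm.sumCongr_mul]; simp
  rw [h, Equiv.Perm.Disjoint.cycleType_mul]
  · congr 1
    · refine cycleType_of_extend (f := Function.Embedding.inl) (by simp) ?_
      rintro (x | x) hx
      · exact (hx x rfl).elim
      · simp
    · refine cycleType_of_extend (f := Function.Embedding.inr) (by simp) ?_
      rintro (x | x) hx
      · simp
      · exact (hx x rfl).elim
  · rintro (x | x)
    · right; simp
    · left; simp

lemma exists_model (s : Multiset ℕ) (hs : ∀ m ∈ s, 1 ≤ m) :
    ∃ σ : Equiv.Perm (Fin s.sum), σ.cycleType = s.filter (2 ≤ ·) ∧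
      ∀ (q : ℕ) (A : Matrix (Fin q) (Fin q) ℂ),
        tr σ A = (s.map fun m => Matrix.trace (A ^ m)).prod := by
  induction s using Multiset.induction with
  | empty =>
    refine ⟨1, Equiv.Perm.cycleType_one.trans (by simp), fun q A => ?_⟩
    simp only [tr, Multiset.map_zero, Multiset.prod_zero]
    change ∑ i : Fin 0 → Fin q, ∏ x : Fin 0, _ = _
    simp
  | cons m s ih =>
    obtain ⟨σ, h1, h2⟩ := ih fun k hk => hs k (Multiset.mem_cons_of_mem hk)
    have hm : 1 ≤ m := hs m (Multiset.mem_cons_self m s)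
    let f : Fin m ⊕ Fin s.sum ≃ Fin (m ::ₘ s).sum :=
      finSumFinEquiv.trans (finCongr (Multiset.sum_cons m s).symm)
    refine ⟨f.permCongr (Equiv.Perm.sumCongr (finRotate m) σ), ?_, fun q A => ?_⟩
    · rw [cycleType_permCongr, cycleType_sumCongr, h1]
      by_cases h : 2 ≤ m
      · rw [cycleType_finRotate_of_le h, Multiset.filter_cons_of_pos _ h, Multiset.singleton_add]
      · have : m = 1 := by omega
        subst this
        rw [Multiset.filter_cons_of_neg _ h, finRotate_one]
        change Equiv.Perm.cycleType 1 + _ = _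
        rw [Equiv.Perm.cycleType_one, zero_add]
    · rw [tr_permCongr, tr_sumCongr, tr_finRotate _ _ hm, h2, Multiset.map_cons,
        Multiset.prod_cons]

lemma count_conj (σ τ : Equiv.Perm α) :
    (∑ π : Equiv.Perm α, if π = τ * π * σ then (1 : ℂ) else 0) =
      if σ.cycleType = τ.cycleType then (Nat.card (Subgroup.centralizer {σ}) : ℂ) else 0 := by
  have key : ∀ π : Equiv.Perm α, π = τ * π * σ ↔ π * σ * π⁻¹ = τ⁻¹ := by
    intro π
    constructor
    · intro h
      rw [mul_inv_eq_iff_eq_mul, eq_inv_mul_iff_mul_eq, ← mul_assoc, ← h]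
    · intro h
      rw [mul_inv_eq_iff_eq_mul, eq_inv_mul_iff_mul_eq, ← mul_assoc] at h
      exact h.symm
  split_ifs with hc
  · obtain ⟨π₀, h0⟩ := isConj_iff.1 (Equiv.Perm.isConj_iff_cycleType_eq.2
      (hc.trans (Equiv.Perm.cycleType_inv τ).symm))
    rw [Finset.sum_boole, ← Fintype.card_subtype, ← Nat.card_eq_fintype_card]
    congr 1
    refine Nat.card_congr ((Equiv.mulLeft π₀⁻¹).subtypeEquiv fun π => ?_)
    rw [key, Subgroup.mem_centralizer_singleton_iff, ← h0]
    simp only [Equiv.coe_mulLeft]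
    constructor
    · intro h
      rw [mul_inv_eq_iff_eq_mul] at h
      rw [mul_assoc, h]
      group
    · intro h
      rw [mul_inv_eq_iff_eq_mul]
      have : π * σ = π₀ * (π₀⁻¹ * π * σ) := by group
      rw [this, h]
      group
  · refine Finset.sum_eq_zero fun π _ => if_neg fun h => hc ?_
    rw [← Equiv.Perm.cycleType_inv τ, ← (key π).1 h, Equiv.Perm.cycleType_conj]

/-- The multiset with `a m` copies of `m`. -/
def ms (t : Finset ℕ) (a : ℕ → ℕ) : Multiset ℕ := ∑ m ∈ t, Multiset.replicate (a m) m

lemma ms_sum (t : Finset ℕ) (a : ℕ → ℕ) : (ms t a).sum = ∑ m ∈ t, m * a m := by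
  rw [ms, ← Multiset.coe_sumAddMonoidHom, map_sum]
  simp [mul_comm]

lemma ms_prod (t : Finset ℕ) (a : ℕ → ℕ) (f : ℕ → ℂ) :
    ((ms t a).map f).prod = ∏ m ∈ t, f m ^ a m := by
  induction t using Finset.induction_on with
  | empty => simp [ms]
  | insert m t hm ih =>
    rw [Finset.prod_insert hm, ← ih, ms, Finset.sum_insert hm]
    simp [ms]

lemma ms_prod_nat (t : Finset ℕ) (a : ℕ → ℕ) :
    (ms t a).prod = ∏ m ∈ t, m ^ a m := by
  induction t using Finset.induction_on with
  | empty => simp [ms]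
  | insert m t hm ih =>
    rw [Finset.prod_insert hm, ← ih, ms, Finset.sum_insert hm]
    simp [ms]

lemma ms_count (t : Finset ℕ) (a : ℕ → ℕ) (k : ℕ) :
    (ms t a).count k = if k ∈ t then a k else 0 := by
  rw [ms, Multiset.count_sum']
  simp [Multiset.count_replicate]

lemma ms_mem {t : Finset ℕ} {a : ℕ → ℕ} {k : ℕ} (h : k ∈ ms t a) : k ∈ t := by
  rw [← Multiset.count_pos, ms_count] at h
  by_contra h'
  simp [h'] at h

lemma ms_filter (l : ℕ) (a : ℕ → ℕ) :
    (ms (Icc 1 l) a).filter (2 ≤ ·) = ms (Icc 2 l) a := by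
  ext k
  rw [Multiset.count_filter, ms_count, ms_count]
  simp only [Finset.mem_Icc]
  split_ifs <;> first | rfl | omega

lemma sum_split (l : ℕ) (hl : 1 ≤ l) (a : ℕ → ℕ) :
    ∑ m ∈ Icc 1 l, m * a m = a 1 + ∑ m ∈ Icc 2 l, m * a m := by
  rw [← Finset.add_sum_Ioc_eq_sum_Icc hl, one_mul]
  rfl

lemma centralizer_card (l : ℕ) (a : ℕ → ℕ) {n : ℕ} (hn : n = ∑ m ∈ Icc 1 l, m * a m)
    (σ : Equiv.Perm (Fin n)) (hσ : σ.cycleType = ms (Icc 2 l) a) :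
    Nat.card (Subgroup.centralizer {σ}) = ∏ m ∈ Icc 1 l, m ^ a m * (a m).factorial := by
  rw [Equiv.Perm.nat_card_centralizer, hσ, ms_sum, ms_prod_nat, Fintype.card_fin]
  have h1 : ∏ m ∈ (ms (Icc 2 l) a).toFinset, ((ms (Icc 2 l) a).count m).factorial =
      ∏ m ∈ Icc 2 l, (a m).factorial := by
    rw [Finset.prod_subset (s₂ := Icc 2 l)]
    · refine Finset.prod_congr rfl fun m hm => ?_
      rw [ms_count, if_pos hm]
    · intro m hm
      exact ms_mem (Multiset.mem_toFinset.1 hm)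
    · intro m _ hm
      rw [Multiset.count_eq_zero.2 (by simpa using hm), Nat.factorial_zero]
  rw [h1]
  rcases Nat.eq_zero_or_pos l with rfl | hl
  · simp at hn ⊢
    simp [hn]
  · rw [hn, sum_split l hl, Nat.add_sub_cancel, ← Finset.mul_prod_Ioc_eq_prod_Icc (a := 1) hl, mul_assoc,
      ← Finset.prod_mul_distrib]
    rw [one_pow, one_mul]
    rfl

end combinatorics

lemma scale_prod (l : ℕ) (a : ℕ → ℕ) (z : ℂ) (A : Matrix (Fin q) (Fin q) ℂ) :
    ∏ m ∈ Icc 1 l, (Matrix.trace ((z • A) ^ m)) ^ a m =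
      z ^ (∑ m ∈ Icc 1 l, m * a m) * ∏ m ∈ Icc 1 l, (Matrix.trace (A ^ m)) ^ a m := by
  rw [← Finset.prod_pow_eq_pow_sum, ← Finset.prod_mul_distrib]
  refine Finset.prod_congr rfl fun m _ => ?_
  rw [smul_pow, Matrix.trace_smul, smul_eq_mul, mul_pow, pow_mul]

end DS
/-- Diaconis–Shahshahani moment formula: for nonnegative integers
`a₁,...,a_l`, `b₁,...,b_l` and `q ≥ max(∑ m·aₘ, ∑ m·bₘ)`, the Haar average over
the unitary group `U(q)` of `∏ₘ Tr(Uᵐ)^{aₘ} Tr(U^{-m})^{bₘ}` equals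
`δ_{a,b} ∏ₘ m^{aₘ} aₘ!`. -/
theorem stmt_10 (q l : ℕ) (a b : ℕ → ℕ)
    (hq : max (∑ m ∈ Finset.Icc 1 l, m * a m) (∑ m ∈ Finset.Icc 1 l, m * b m) ≤ q)
    [MeasurableSpace (Matrix.unitaryGroup (Fin q) ℂ)]
    [BorelSpace (Matrix.unitaryGroup (Fin q) ℂ)]
    (μ : Measure (Matrix.unitaryGroup (Fin q) ℂ))
    [μ.IsHaarMeasure] [IsProbabilityMeasure μ] :
    ∫ U : Matrix.unitaryGroup (Fin q) ℂ,
        (∏ m ∈ Finset.Icc 1 l,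
          (Matrix.trace ((U : Matrix (Fin q) (Fin q) ℂ) ^ m)) ^ a m *
          (Matrix.trace (((U⁻¹ : Matrix.unitaryGroup (Fin q) ℂ) :
              Matrix (Fin q) (Fin q) ℂ) ^ m)) ^ b m) ∂μ =
      if ∀ m ∈ Finset.Icc 1 l, a m = b m then
        ∏ m ∈ Finset.Icc 1 l, (m : ℂ) ^ a m * ((a m).factorial : ℂ)
      else 0 := by
  simp_rw [Finset.prod_mul_distrib]
  by_cases hn : ∑ m ∈ Finset.Icc 1 l, m * a m = ∑ m ∈ Finset.Icc 1 l, m * b m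
  · obtain ⟨σ, hσ, hσt⟩ := DS.exists_model (DS.ms (Icc 1 l) a)
      fun m hm => (Finset.mem_Icc.1 (DS.ms_mem hm)).1
    obtain ⟨τ', hτ', hτt'⟩ := DS.exists_model (DS.ms (Icc 1 l) b)
      fun m hm => (Finset.mem_Icc.1 (DS.ms_mem hm)).1
    have hN : (DS.ms (Icc 1 l) b).sum = (DS.ms (Icc 1 l) a).sum := by
      rw [DS.ms_sum, DS.ms_sum, hn]
    obtain ⟨τ, hτ, hτt⟩ : ∃ τ : Equiv.Perm (Fin (DS.ms (Icc 1 l) a).sum),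
        τ.cycleType = (DS.ms (Icc 1 l) b).filter (2 ≤ ·) ∧
        ∀ (q : ℕ) (A : Matrix (Fin q) (Fin q) ℂ),
          DS.tr τ A = ((DS.ms (Icc 1 l) b).map fun m => Matrix.trace (A ^ m)).prod :=
      ⟨(finCongr hN).permCongr τ', by rw [DS.cycleType_permCongr, hτ'],
        fun q A => by rw [DS.tr_permCongr, hτt']⟩
    rw [DS.ms_filter] at hσ hτ
    simp_rw [DS.ms_prod] at hσt hτt
    simp_rw [← hσt, ← hτt]
    have hle : (DS.ms (Icc 1 l) a).sum ≤ q := by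
      rw [DS.ms_sum]; exact (le_max_left _ _).trans hq
    rw [DS.main_integral μ (Fin.castLE_injective hle), DS.count_conj]
    have hiff : σ.cycleType = τ.cycleType ↔ ∀ m ∈ Finset.Icc 1 l, a m = b m := by
      rw [hσ, hτ]
      constructor
      · intro h
        have h2 : ∀ m ∈ Icc 2 l, a m = b m := by
          intro m hm
          have := congrArg (Multiset.count m) h
          rwa [DS.ms_count, DS.ms_count, if_pos hm, if_pos hm] at this
        intro m hm
        rw [Finset.mem_Icc] at hm
        by_cases hm2 : 2 ≤ m
        · exact h2 m (Finset.mem_Icc.2 ⟨hm2, hm.2⟩)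
        · have : m = 1 := by omega
          subst this
          rw [DS.sum_split l hm.2, DS.sum_split l hm.2,
            Finset.sum_congr rfl (fun k hk => by rw [h2 k hk])] at hn
          exact Nat.add_right_cancel hn
      · intro h
        refine Finset.sum_congr rfl fun m hm => ?_
        rw [Finset.mem_Icc] at hm
        rw [h m (Finset.mem_Icc.2 ⟨by omega, hm.2⟩)]
    simp only [hiff]
    split_ifs with h
    · rw [DS.centralizer_card l a (DS.ms_sum _ _) σ hσ, ← Finset.prod_mul_distrib]
      push_cast
      rfl
    · rfl
  · rw [if_neg fun h => hn (Finset.sum_congr rfl fun m hm => by rw [h m hm])]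
    obtain ⟨z, hz, hz'⟩ := DS.exists_unit
    let Z : Matrix.unitaryGroup (Fin q) ℂ :=
      ⟨Matrix.diagonal fun _ => z, DS.diag_mem fun _ => hz⟩
    have hZ1 : ∀ U : Matrix.unitaryGroup (Fin q) ℂ,
        ((Z * U : Matrix.unitaryGroup (Fin q) ℂ) : Matrix (Fin q) (Fin q) ℂ) =
          z • (U : Matrix (Fin q) (Fin q) ℂ) := by
      intro U
      rw [Matrix.UnitaryGroup.mul_val, Matrix.smul_eq_diagonal_mul]
    have hZ2 : ∀ U : Matrix.unitaryGroup (Fin q) ℂ,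
        (((Z * U)⁻¹ : Matrix.unitaryGroup (Fin q) ℂ) : Matrix (Fin q) (Fin q) ℂ) =
          star z • ((U⁻¹ : Matrix.unitaryGroup (Fin q) ℂ) : Matrix (Fin q) (Fin q) ℂ) := by
      intro U
      rw [Matrix.UnitaryGroup.inv_val, hZ1, star_smul, Matrix.UnitaryGroup.inv_val]
    have h := integral_mul_left_eq_self (μ := μ) (fun U : Matrix.unitaryGroup (Fin q) ℂ =>
      (∏ m ∈ Icc 1 l, (Matrix.trace ((U : Matrix (Fin q) (Fin q) ℂ) ^ m)) ^ a m) *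
      (∏ m ∈ Icc 1 l, (Matrix.trace (((U⁻¹ : Matrix.unitaryGroup (Fin q) ℂ) :
              Matrix (Fin q) (Fin q) ℂ) ^ m)) ^ b m)) Z
    simp only [hZ1, hZ2, DS.scale_prod] at h
    simp_rw [mul_mul_mul_comm] at h
    rw [integral_const_mul] at h
    by_contra h0
    have h1 := mul_right_cancel₀ h0 (h.trans (one_mul _).symm)
    apply hn
    apply hz'
    have h2 := congrArg (· * z ^ (∑ m ∈ Finset.Icc 1 l, m * b m)) h1
    simp only [mul_assoc, ← mul_pow, hz, one_pow, mul_one, one_mul] at h2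
    exact h2
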